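/- arXiv:1903.05975 — 3 statements merged into one kernel-verified Lean document; each statement's English description precedes it below -/
import Mathlib

section
/- Let (U, T) be a Betweenness instance with U = {u_1,…,u_n} and T = {t_1,…,t_m} a set of ordered triples of pairwise distinct elements of U. Construct the incomplete preference profile P without ties on agent set U ∪ {a_1,…,a_m, a'_1,…,a'_m} as follows: each element agent u_i finds acceptable exactly the agents in A(u_i) ∪ A'(u_i), where A(u_i) = {a_j : u_i ∈ t_j} and A'(u_i) = {a'_j : u_i ∈ t_j}, ranked by the linear order consistent with L := a_1 ≻ ⋯ ≻ a_m ≻ a'_1 ≻ ⋯ ≻ a'_m; and for each triple t_j = (x,y,z), agent a_j has preference y ≻ x ≻ z and agent a'_j has preference y ≻ z ≻ x. Then P is single-peaked if and only if (U, T) admits a betweenness order. -/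
/-!
Basic framework: preference profiles with possibly incomplete preferences and ties,
structured-preference properties (narcissistic, single-peaked, single-crossing,
tie-sensitive single-crossing), matchings, blocking pairs and stability.
-/

/-- A preference profile: each agent `i` has a weak order `pref i` (transitive and
total) on its acceptable set `acc i`.  `pref i x y` means agent `i` weakly prefers
`x` to `y`. -/
structure Profile (V : Type*) where
  acc : V → Set V
  pref : V → V → V → Prop
  pref_mem : ∀ i x y, pref i x y → x ∈ acc i ∧ y ∈ acc i
  pref_total : ∀ i x y, x ∈ acc i → y ∈ acc i → pref i x y ∨ pref i y x
  pref_trans : ∀ i x y z, pref i x y → pref i y z → pref i x z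

namespace Profile

variable {V : Type*} (P : Profile V)

/-- `i` strictly prefers `x` to `y`. -/
def Strict (i x y : V) : Prop := P.pref i x y ∧ ¬ P.pref i y x

/-- `i` is indifferent between (ties) `x` and `y`. -/
def Indiff (i x y : V) : Prop := P.pref i x y ∧ P.pref i y x

/-- Acceptability is symmetric between distinct agents. -/
def AccSymm : Prop := ∀ i j : V, i ≠ j → (j ∈ P.acc i ↔ i ∈ P.acc j)

/-- The profile has no ties. -/
def NoTies : Prop := ∀ i x y : V, x ≠ y → ¬ P.Indiff i x y

/-- The profile is complete: `V(≽ᵢ) ∪ {i} = V` for every agent `i`. -/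
def IsComplete : Prop := ∀ i : V, P.acc i ∪ {i} = Set.univ

/-- The profile is narcissistic. -/
def Narcissistic : Prop :=
  ∀ i : V, i ∈ P.acc i ∧ ∀ j ∈ P.acc i, j ≠ i → P.Strict i i j

/-- The agents of a set `S` are narcissistic. -/
def NarcissisticOn (S : Set V) : Prop :=
  ∀ i ∈ S, i ∈ P.acc i ∧ ∀ j ∈ P.acc i, j ≠ i → P.Strict i i j

/-- `X ▷ Y` : every member of `X` strictly precedes every member of `Y` w.r.t. `lt`. -/
def SetBefore (lt : V → V → Prop) (X Y : Set V) : Prop :=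
  ∀ x ∈ X, ∀ y ∈ Y, lt x y

/-- `V[x ≻ y]`: the agents that find both `x` and `y` acceptable and strictly
prefer `x` to `y`. -/
def prefersSet (x y : V) : Set V :=
  {i | x ∈ P.acc i ∧ y ∈ P.acc i ∧ P.Strict i x y}

/-- `V[x ∼ y]`: the agents that find both `x` and `y` acceptable and are
indifferent between them. -/
def tiesSet (x y : V) : Set V :=
  {i | x ∈ P.acc i ∧ y ∈ P.acc i ∧ P.Indiff i x y}

/-- `V[x ≻ y]` restricted to the agents of `S`. -/
def prefersSetOn (S : Set V) (x y : V) : Set V :=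
  {i | i ∈ S ∧ x ∈ P.acc i ∧ y ∈ P.acc i ∧ P.Strict i x y}

/-- `V[x ∼ y]` restricted to the agents of `S`. -/
def tiesSetOn (S : Set V) (x y : V) : Set V :=
  {i | i ∈ S ∧ x ∈ P.acc i ∧ y ∈ P.acc i ∧ P.Indiff i x y}

/-- The profile is single-peaked with respect to the linear order `lt`. -/
def SinglePeakedWrt (lt : V → V → Prop) : Prop :=
  ∀ i x y z : V, x ∈ P.acc i → y ∈ P.acc i → z ∈ P.acc i →
    lt x y → lt y z → P.Strict i x y → P.pref i y z

/-- The profile is single-peaked. -/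
def SinglePeaked : Prop :=
  ∃ lt : V → V → Prop, IsStrictTotalOrder V lt ∧ P.SinglePeakedWrt lt

/-- The preferences of the agents of `S` are single-peaked w.r.t. `lt`. -/
def SinglePeakedWrtOn (S : Set V) (lt : V → V → Prop) : Prop :=
  ∀ i ∈ S, ∀ x y z : V, x ∈ P.acc i → y ∈ P.acc i → z ∈ P.acc i →
    lt x y → lt y z → P.Strict i x y → P.pref i y z

/-- The profile is tie-sensitive single-crossing with respect to `lt`:
for each pair `{x, y}` of distinct agents either
`V[x ≻ y] ▷ V[x ∼ y] ▷ V[y ≻ x]` or `V[y ≻ x] ▷ V[x ∼ y] ▷ V[x ≻ y]`. -/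
def TSSingleCrossingWrt (lt : V → V → Prop) : Prop :=
  ∀ x y : V, x ≠ y →
    (SetBefore lt (P.prefersSet x y) (P.tiesSet x y) ∧
     SetBefore lt (P.tiesSet x y) (P.prefersSet y x) ∧
     SetBefore lt (P.prefersSet x y) (P.prefersSet y x)) ∨
    (SetBefore lt (P.prefersSet y x) (P.tiesSet x y) ∧
     SetBefore lt (P.tiesSet x y) (P.prefersSet x y) ∧
     SetBefore lt (P.prefersSet y x) (P.prefersSet x y))

/-- The profile is tie-sensitive single-crossing. -/
def TSSingleCrossing : Prop :=
  ∃ lt : V → V → Prop, IsStrictTotalOrder V lt ∧ P.TSSingleCrossingWrt lt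

/-- Tie-sensitive single-crossingness of the preferences of the agents of `S`. -/
def TSSingleCrossingWrtOn (S : Set V) (lt : V → V → Prop) : Prop :=
  ∀ x y : V, x ≠ y →
    (SetBefore lt (P.prefersSetOn S x y) (P.tiesSetOn S x y) ∧
     SetBefore lt (P.tiesSetOn S x y) (P.prefersSetOn S y x) ∧
     SetBefore lt (P.prefersSetOn S x y) (P.prefersSetOn S y x)) ∨
    (SetBefore lt (P.prefersSetOn S y x) (P.tiesSetOn S x y) ∧
     SetBefore lt (P.tiesSetOn S x y) (P.prefersSetOn S x y) ∧
     SetBefore lt (P.prefersSetOn S y x) (P.prefersSetOn S x y))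

/-- `ext` is a linear extension of the profile: for every agent `i`, `ext i` is a
strict linear order on the acceptable set `acc i` that contains `Strict i`. -/
def IsLinearExt (ext : V → V → V → Prop) : Prop :=
  (∀ i x y, ext i x y → x ∈ P.acc i ∧ y ∈ P.acc i) ∧
  (∀ i x, ¬ ext i x x) ∧
  (∀ i x y z, ext i x y → ext i y z → ext i x z) ∧
  (∀ i x y, x ∈ P.acc i → y ∈ P.acc i → x ≠ y → (ext i x y ∨ ext i y x)) ∧
  (∀ i x y, ext i x y → ¬ ext i y x) ∧
  (∀ i x y, P.Strict i x y → ext i x y)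

/-- `V[x ≻' y]` for a linear extension `ext`. -/
def extPrefersSet (ext : V → V → V → Prop) (x y : V) : Set V :=
  {i | x ∈ P.acc i ∧ y ∈ P.acc i ∧ ext i x y}

/-- The linear extension `ext` witnesses single-crossingness w.r.t. `lt`. -/
def SingleCrossingWrtVia (ext : V → V → V → Prop) (lt : V → V → Prop) : Prop :=
  ∀ x y : V, x ≠ y →
    SetBefore lt (P.extPrefersSet ext x y) (P.extPrefersSet ext y x) ∨
    SetBefore lt (P.extPrefersSet ext y x) (P.extPrefersSet ext x y)

/-- The profile is single-crossing with respect to `lt`: some linear extension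
of the profile crosses each pair at most once along `lt`. -/
def SingleCrossingWrt (lt : V → V → Prop) : Prop :=
  ∃ ext : V → V → V → Prop, P.IsLinearExt ext ∧ P.SingleCrossingWrtVia ext lt

/-- The profile is single-crossing. -/
def SingleCrossing : Prop :=
  ∃ lt : V → V → Prop, IsStrictTotalOrder V lt ∧ P.SingleCrossingWrt lt

/-- Single-crossingness w.r.t. `lt` for profiles without ties, stated directly via
the strict preferences. -/
def SCNoTiesWrt (lt : V → V → Prop) : Prop :=
  ∀ x y : V, x ≠ y →
    SetBefore lt (P.prefersSet x y) (P.prefersSet y x) ∨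
    SetBefore lt (P.prefersSet y x) (P.prefersSet x y)

/-- `x` is a most acceptable agent of `y`. -/
def MostAcceptable (x y : V) : Prop :=
  x ∈ P.acc y ∧ x ≠ y ∧ ∀ z ∈ P.acc y, z ≠ x → z ≠ y → P.pref y x z

/-- A matching: a set of pairwise disjoint pairs of distinct, mutually acceptable
agents, encoded by the partner function `m` (`m x = none` iff `x` is unmatched). -/
structure Matching (Q : Profile V) where
  m : V → Option V
  ne : ∀ x y, m x = some y → x ≠ y
  mutual_acc : ∀ x y, m x = some y → y ∈ Q.acc x ∧ x ∈ Q.acc y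
  symm : ∀ x y, m x = some y → m y = some x

/-- The (mutually acceptable, unmatched) pair `{x, y}` blocks the matching `M`. -/
def Matching.Blocks {Q : Profile V} (M : Q.Matching) (x y : V) : Prop :=
  x ≠ y ∧ y ∈ Q.acc x ∧ x ∈ Q.acc y ∧ M.m x ≠ some y ∧
  (∀ z, M.m x = some z → Q.Strict x y z) ∧
  (∀ z, M.m y = some z → Q.Strict y x z)

/-- A matching is stable if no pair blocks it. -/
def Matching.Stable {Q : Profile V} (M : Q.Matching) : Prop :=
  ∀ x y : V, ¬ M.Blocks x y

/-- A matching is perfect if every agent is matched. -/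
def Matching.Perfect {Q : Profile V} (M : Q.Matching) : Prop :=
  ∀ x : V, M.m x ≠ none

/-- Build a profile from ranking functions (`none` = unacceptable, smaller rank =
more preferred). -/
def ofRank {V : Type*} (rk : V → V → Option ℕ) : Profile V where
  acc i := {x | rk i x ≠ none}
  pref i x y := ∃ a b : ℕ, rk i x = some a ∧ rk i y = some b ∧ a ≤ b
  pref_mem i x y := by
    rintro ⟨a, b, ha, hb, -⟩
    constructor <;> simp only [Set.mem_setOf_eq, ha, hb] <;> simp
  pref_total i x y hx hy := by
    obtain ⟨a, ha⟩ := Option.ne_none_iff_exists'.mp hx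
    obtain ⟨b, hb⟩ := Option.ne_none_iff_exists'.mp hy
    rcases le_total a b with h | h
    · exact Or.inl ⟨a, b, ha, hb, h⟩
    · exact Or.inr ⟨b, a, hb, ha, h⟩
  pref_trans i x y z := by
    rintro ⟨a, b, ha, hb, hab⟩ ⟨b', c, hb', hc, hbc⟩
    refine ⟨a, c, ha, hc, hab.trans ?_⟩
    rw [hb] at hb'
    rwa [Option.some_inj.mp hb']

end Profile

/-- Agents of the single-peakedness reduction: element agents `Sum.inl i` (`u_i`),
and triple agents `Sum.inr (Sum.inl j)` (`a_j`) and `Sum.inr (Sum.inr j)` (`a'_j`). -/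
abbrev BetwAgent (n m : ℕ) := Fin n ⊕ (Fin m ⊕ Fin m)

/-- Ranking table of the reduction: for a triple `t_j = (tx j, ty j, tz j)`, the
element agent `u_i` ranks the acceptable triple agents consistently with
`a_1 ≻ ⋯ ≻ a_m ≻ a'_1 ≻ ⋯ ≻ a'_m`, the agent `a_j` has preferences `y ≻ x ≻ z`,
and the agent `a'_j` has preferences `y ≻ z ≻ x`. -/
def betwRank (n m : ℕ) (tx ty tz : Fin m → Fin n) :
    BetwAgent n m → BetwAgent n m → Option ℕ
  | Sum.inl i, Sum.inr (Sum.inl j) =>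
      if i = tx j ∨ i = ty j ∨ i = tz j then some j.1 else none
  | Sum.inl i, Sum.inr (Sum.inr j) =>
      if i = tx j ∨ i = ty j ∨ i = tz j then some (m + j.1) else none
  | Sum.inr (Sum.inl j), Sum.inl i =>
      if i = ty j then some 0 else if i = tx j then some 1
      else if i = tz j then some 2 else none
  | Sum.inr (Sum.inr j), Sum.inl i =>
      if i = ty j then some 0 else if i = tz j then some 1
      else if i = tx j then some 2 else none
  | _, _ => none

/-- In a single-peaked profile, an agent ranked below two others does not lie between them. -/
theorem Profile.SinglePeakedWrt.not_between_of_rank_lt {V : Type*} {rk : V → V → Option ℕ}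
    {lt : V → V → Prop} (h : (Profile.ofRank rk).SinglePeakedWrt lt) {i x y z : V} (a b c : ℕ)
    (hx : rk i x = some a) (hy : rk i y = some b) (hz : rk i z = some c)
    (hab : a < b) (hcb : c < b) (hxy : lt x y) : ¬ lt y z := by
  intro hyz
  obtain ⟨b', c', hb', hc', hle⟩ := h i x y z (by simp [Profile.ofRank, hx])
    (by simp [Profile.ofRank, hy]) (by simp [Profile.ofRank, hz]) hxy hyz
    ⟨⟨a, b, hx, hy, hab.le⟩, by
      rintro ⟨b', a', hb', ha', hle⟩
      rw [hy, Option.some_inj] at hb'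
      rw [hx, Option.some_inj] at ha'
      omega⟩
  rw [hy, Option.some_inj] at hb'
  rw [hz, Option.some_inj] at hc'
  omega

section Reduction

variable {n m : ℕ} (tx ty tz : Fin m → Fin n)

theorem mem_acc_inr (s : Fin m ⊕ Fin m) (p : BetwAgent n m) :
    p ∈ (Profile.ofRank (betwRank n m tx ty tz)).acc (Sum.inr s) ↔
      ∃ u, p = Sum.inl u ∧ (u = tx (s.elim id id) ∨ u = ty (s.elim id id) ∨
        u = tz (s.elim id id)) := by
  rcases p with u | p <;> rcases s with j | j
  · simp only [Profile.ofRank, betwRank, Set.mem_ofPred_eq, Sum.inl.injEq, Sum.elim_inl, id]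
    grind
  · simp only [Profile.ofRank, betwRank, Set.mem_ofPred_eq, Sum.inl.injEq, Sum.elim_inr, id]
    grind
  all_goals simp [Profile.ofRank, betwRank]

/-- The middle element of a triple is ranked first by both of its triple agents. -/
theorem betwRank_middle (s : Fin m ⊕ Fin m) :
    betwRank n m tx ty tz (Sum.inr s) (Sum.inl (ty (s.elim id id))) = some 0 := by
  rcases s with j | j <;> simp [betwRank]

/-- Element agents prefer triple agents that come earlier in the lexicographic order. -/
theorem pref_element_of_lex (bo : Fin n → Fin n → Prop) {u : Fin n} {q r : BetwAgent n m}
    (hq : q ∈ (Profile.ofRank (betwRank n m tx ty tz)).acc (Sum.inl u))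
    (hr : r ∈ (Profile.ofRank (betwRank n m tx ty tz)).acc (Sum.inl u))
    (hqr : Sum.Lex bo (Sum.Lex (· < ·) (· < ·)) q r) :
    (Profile.ofRank (betwRank n m tx ty tz)).pref (Sum.inl u) q r := by
  rcases q with q | q | q <;> rcases r with r | r | r <;>
    simp [Profile.ofRank, betwRank] at hq hr hqr ⊢ <;> grind

end Reduction

/-- The middle one of three points of `{x, y, z}` is `y` if `y` lies between `x` and `z`. -/
theorem eq_of_between {α : Type*} {r : α → α → Prop} [IsStrictTotalOrder α r] {x y z a b c : α}
    (h : (r x y ∧ r y z) ∨ (r z y ∧ r y x)) (ha : a = x ∨ a = y ∨ a = z)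
    (hb : b = x ∨ b = y ∨ b = z) (hc : c = x ∨ c = y ∨ c = z) (hab : r a b) (hbc : r b c) :
    b = y := by
  have hirr : ∀ a, ¬ r a a := irrefl_of r
  have htr : ∀ a b c, r a b → r b c → r a c := fun _ _ _ => trans_of r
  grind

/-- The incomplete profile without ties constructed from a
Betweenness instance `(U, T)` (with `t_j = (tx j, ty j, tz j)`) is single-peaked if
and only if `(U, T)` admits a betweenness order. -/
theorem singlePeaked_iff_betweenness (n m : ℕ) (tx ty tz : Fin m → Fin n)
    (hdist : ∀ j, tx j ≠ ty j ∧ tx j ≠ tz j ∧ ty j ≠ tz j) :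
    (Profile.ofRank (betwRank n m tx ty tz)).SinglePeaked ↔
    ∃ bo : Fin n → Fin n → Prop, IsStrictTotalOrder (Fin n) bo ∧
      ∀ j : Fin m, (bo (tx j) (ty j) ∧ bo (ty j) (tz j)) ∨
        (bo (tz j) (ty j) ∧ bo (ty j) (tx j)) := by
  constructor
  · rintro ⟨lt, hlt, hsp⟩
    refine ⟨fun u v => lt (Sum.inl u) (Sum.inl v), ?_, fun j => ?_⟩
    · exact (RelEmbedding.preimage ⟨Sum.inl, Sum.inl_injective⟩ lt).isStrictTotalOrder
    · obtain ⟨hxy, hxz, hyz⟩ := hdist j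
      have hz := fun p q => hsp.not_between_of_rank_lt (i := Sum.inr (Sum.inl j)) (x := p)
        (y := Sum.inl (tz j)) (z := q)
      have hx := fun p q => hsp.not_between_of_rank_lt (i := Sum.inr (Sum.inr j)) (x := p)
        (y := Sum.inl (tx j)) (z := q)
      have hz₁ := hz (Sum.inl (tx j)) (Sum.inl (ty j)) 1 2 0
        (by simp [betwRank, hxy]) (by simp [betwRank, hxz.symm, hyz.symm]) (by simp [betwRank])
        (by simp) (by simp)
      have hz₂ := hz (Sum.inl (ty j)) (Sum.inl (tx j)) 0 2 1
        (by simp [betwRank]) (by simp [betwRank, hxz.symm, hyz.symm]) (by simp [betwRank, hxy])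
        (by simp) (by simp)
      have hx₁ := hx (Sum.inl (tz j)) (Sum.inl (ty j)) 1 2 0
        (by simp [betwRank, hyz.symm]) (by simp [betwRank, hxy, hxz]) (by simp [betwRank])
        (by simp) (by simp)
      have hx₂ := hx (Sum.inl (ty j)) (Sum.inl (tz j)) 0 2 1
        (by simp [betwRank]) (by simp [betwRank, hxy, hxz]) (by simp [betwRank, hyz.symm])
        (by simp) (by simp)
      have txy := trichotomous_of lt (Sum.inl (tx j)) (Sum.inl (ty j))
      have txz := trichotomous_of lt (Sum.inl (tx j)) (Sum.inl (tz j))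
      have tyz := trichotomous_of lt (Sum.inl (ty j)) (Sum.inl (tz j))
      simp only [Sum.inl.injEq, hxy, hxz, hyz, false_or] at txy txz tyz
      tauto
  · rintro ⟨bo, hbo, hb⟩
    refine ⟨Sum.Lex bo (Sum.Lex (· < ·) (· < ·)), { }, ?_⟩
    rintro (u | s) p q r hp hq hr hpq hqr -
    · exact pref_element_of_lex tx ty tz bo hq hr hqr
    · obtain ⟨b, hrb⟩ := Option.ne_none_iff_exists'.mp hr
      rw [mem_acc_inr] at hp hq hr
      obtain ⟨p, rfl, hp⟩ := hp
      obtain ⟨q, rfl, hq⟩ := hq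
      obtain ⟨r, rfl, hr⟩ := hr
      rw [Sum.lex_inl_inl] at hpq hqr
      obtain rfl := eq_of_between (hb (s.elim id id)) hp hq hr hpq hqr
      exact ⟨0, b, betwRank_middle tx ty tz s, hrb, b.zero_le⟩
end

section
/- Let (U, T) be a Betweenness instance with U = {u_1,…,u_n} and T = {t_1,…,t_m} a set of ordered triples of pairwise distinct elements of U. Construct the incomplete preference profile P without ties on agent set U ∪ {a_j, b_j, c_j : 1 ≤ j ≤ m} as follows: for each triple t_j = (x,y,z), the agents a_j, b_j, c_j each have acceptable set {x,y,z}, ranked in ascending order of the indices of x, y, z in U; each element agent u finds acceptable exactly the agents in T_j := {a_j, b_j, c_j} for the triples t_j containing u, with the blocks T_j ranked in ascending order of j, and within each block T_j with t_j = (x,y,z): if u = x then a_j ≻ b_j ≻ c_j; if u = y then b_j ≻ a_j ≻ c_j; if u = z then c_j ≻ b_j ≻ a_j. Then P is single-crossing if and only if (U, T) admits a betweenness order. -/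
/-- Agents of the single-crossingness reduction: element agents `Sum.inl i` (`u_i`)
and triple agents `Sum.inr (j, s)` with `s = 0, 1, 2` for `a_j, b_j, c_j`. -/
abbrev BetwSCAgent (n m : ℕ) := Fin n ⊕ (Fin m × Fin 3)

/-- Ranking table of the reduction: for a triple `t_j = (tx j, ty j, tz j)`, the
triple agents `a_j, b_j, c_j` rank `{x, y, z}` ascending by index in `U`; the
element agent `u` ranks the acceptable blocks `T_j = {a_j, b_j, c_j}` ascending in
`j` and, within block `T_j`, `a_j ≻ b_j ≻ c_j` if `u = x`, `b_j ≻ a_j ≻ c_j` if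
`u = y`, and `c_j ≻ b_j ≻ a_j` if `u = z`. -/
def betwSCRank (n m : ℕ) (tx ty tz : Fin m → Fin n) :
    BetwSCAgent n m → BetwSCAgent n m → Option ℕ
  | Sum.inl i, Sum.inr (j, s) =>
      if i = tx j then some (3 * j.1 + (![0, 1, 2] : Fin 3 → ℕ) s)
      else if i = ty j then some (3 * j.1 + (![1, 0, 2] : Fin 3 → ℕ) s)
      else if i = tz j then some (3 * j.1 + (![2, 1, 0] : Fin 3 → ℕ) s)
      else none
  | Sum.inr (j, _), Sum.inl i =>
      if i = tx j ∨ i = ty j ∨ i = tz j then some i.1 else none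
  | _, _ => none

/-- An agent of a rank-defined profile prefers `x` to `y` iff it ranks both, with `x` first. -/
theorem Profile.mem_prefersSet_ofRank {V : Type*} {rk : V → V → Option ℕ} {i x y : V} :
    i ∈ (Profile.ofRank rk).prefersSet x y ↔
      ∃ a b : ℕ, rk i x = some a ∧ rk i y = some b ∧ a < b := by
  constructor
  · rintro ⟨-, -, ⟨a, b, ha, hb, -⟩, h⟩
    exact ⟨a, b, ha, hb, not_le.mp fun hba => h ⟨b, a, hb, ha, hba⟩⟩
  · rintro ⟨a, b, ha, hb, hab⟩
    refine ⟨by simp [Profile.ofRank, ha], by simp [Profile.ofRank, hb],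
      ⟨a, b, ha, hb, hab.le⟩, ?_⟩
    rintro ⟨b', a', hb', ha', h⟩
    rw [hb] at hb'
    rw [ha] at ha'
    simp only [Option.some.injEq] at hb' ha'
    omega

theorem Profile.prefersSet_ofRank_eq_empty {V : Type*} {rk : V → V → Option ℕ} {x y : V}
    (h : ∀ i a b, rk i x = some a → rk i y = some b → b ≤ a) :
    (Profile.ofRank rk).prefersSet x y = ∅ := by
  refine Set.eq_empty_iff_forall_notMem.mpr fun i hi => ?_
  obtain ⟨a, b, ha, hb, hab⟩ := Profile.mem_prefersSet_ofRank.mp hi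
  exact (h i a b ha hb).not_gt hab

/-- If `x` never strictly precedes `y`, the pair `x, y` is crossed at most once. -/
theorem Profile.setBefore_prefersSet_ofRank {V : Type*} {rk : V → V → Option ℕ} {x y : V}
    (lt : V → V → Prop) (h : ∀ i a b, rk i x = some a → rk i y = some b → b ≤ a) :
    SetBefore lt ((Profile.ofRank rk).prefersSet x y) ((Profile.ofRank rk).prefersSet y x) ∧
    SetBefore lt ((Profile.ofRank rk).prefersSet y x) ((Profile.ofRank rk).prefersSet x y) := by
  simp [Profile.prefersSet_ofRank_eq_empty h, SetBefore]

section BetwSC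

variable {n m : ℕ} {tx ty tz : Fin m → Fin n}

theorem betwSCRank_inl_bounds {i : Fin n} {j : Fin m} {s : Fin 3} {a : ℕ}
    (h : betwSCRank n m tx ty tz (Sum.inl i) (Sum.inr (j, s)) = some a) :
    3 * j.1 ≤ a ∧ a < 3 * j.1 + 3 := by
  simp only [betwSCRank] at h
  split_ifs at h <;> fin_cases s <;> simp at h <;> omega

theorem mem_prefersSet_betwSCRank_block (hdist : ∀ j, tx j ≠ ty j ∧ tx j ≠ tz j ∧ ty j ≠ tz j)
    {j : Fin m} {s t : Fin 3} {v : BetwSCAgent n m} :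
    v ∈ (Profile.ofRank (betwSCRank n m tx ty tz)).prefersSet (Sum.inr (j, s)) (Sum.inr (j, t)) ↔
      (v = Sum.inl (tx j) ∧ (![0, 1, 2] : Fin 3 → ℕ) s < (![0, 1, 2] : Fin 3 → ℕ) t) ∨
      (v = Sum.inl (ty j) ∧ (![1, 0, 2] : Fin 3 → ℕ) s < (![1, 0, 2] : Fin 3 → ℕ) t) ∨
      (v = Sum.inl (tz j) ∧ (![2, 1, 0] : Fin 3 → ℕ) s < (![2, 1, 0] : Fin 3 → ℕ) t) := by
  obtain ⟨hxy, hxz, hyz⟩ := hdist j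
  rw [Profile.mem_prefersSet_ofRank]
  obtain i | k := v
  · simp only [betwSCRank, Sum.inl.injEq]
    split_ifs <;> subst_vars <;> simp_all
  · simp [betwSCRank]

/-- The block of the triple `t_j` is crossed at most once iff `ty j` lies between
`tx j` and `tz j`. -/
theorem block_setBefore_iff (hdist : ∀ j, tx j ≠ ty j ∧ tx j ≠ tz j ∧ ty j ≠ tz j)
    {lt : BetwSCAgent n m → BetwSCAgent n m → Prop} [IsStrictTotalOrder _ lt] (j : Fin m) :
    (∀ s t : Fin 3, s ≠ t →
      Profile.SetBefore lt
        ((Profile.ofRank (betwSCRank n m tx ty tz)).prefersSet (Sum.inr (j, s)) (Sum.inr (j, t)))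
        ((Profile.ofRank (betwSCRank n m tx ty tz)).prefersSet (Sum.inr (j, t)) (Sum.inr (j, s))) ∨
      Profile.SetBefore lt
        ((Profile.ofRank (betwSCRank n m tx ty tz)).prefersSet (Sum.inr (j, t)) (Sum.inr (j, s)))
        ((Profile.ofRank (betwSCRank n m tx ty tz)).prefersSet (Sum.inr (j, s)) (Sum.inr (j, t)))) ↔
    (lt (Sum.inl (tx j)) (Sum.inl (ty j)) ∧ lt (Sum.inl (ty j)) (Sum.inl (tz j))) ∨
      (lt (Sum.inl (tz j)) (Sum.inl (ty j)) ∧ lt (Sum.inl (ty j)) (Sum.inl (tx j))) := by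
  have htrans : ∀ {u v w}, lt u v → lt v w → lt u w := fun h h' => _root_.trans h h'
  have hasymm : ∀ {u v}, lt u v → ¬ lt v u := fun h => asymm h
  simp only [Profile.SetBefore, mem_prefersSet_betwSCRank_block hdist]
  constructor
  · intro h
    have h₀₁ := h 0 1 (by decide)
    have h₁₂ := h 1 2 (by decide)
    simp at h₀₁ h₁₂
    grind
  · intro h s t hst
    fin_cases s <;> fin_cases t <;> simp at hst ⊢ <;> grind

end BetwSC

/-- The incomplete profile without ties constructed from a
Betweenness instance `(U, T)` (with `t_j = (tx j, ty j, tz j)`) is single-crossing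
if and only if `(U, T)` admits a betweenness order. -/
theorem singleCrossing_iff_betweenness (n m : ℕ) (tx ty tz : Fin m → Fin n)
    (hdist : ∀ j, tx j ≠ ty j ∧ tx j ≠ tz j ∧ ty j ≠ tz j) :
    (∃ lt : BetwSCAgent n m → BetwSCAgent n m → Prop,
      IsStrictTotalOrder (BetwSCAgent n m) lt ∧
      (Profile.ofRank (betwSCRank n m tx ty tz)).SCNoTiesWrt lt) ↔
    ∃ bo : Fin n → Fin n → Prop, IsStrictTotalOrder (Fin n) bo ∧
      ∀ j : Fin m, (bo (tx j) (ty j) ∧ bo (ty j) (tz j)) ∨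
        (bo (tz j) (ty j) ∧ bo (ty j) (tx j)) := by
  constructor
  · rintro ⟨lt, hlt, hsc⟩
    refine ⟨fun u v => lt (Sum.inl u) (Sum.inl v),
      (RelEmbedding.preimage Function.Embedding.inl lt).isStrictTotalOrder, fun j => ?_⟩
    exact (block_setBefore_iff hdist j).mp fun s t hst =>
      hsc (Sum.inr (j, s)) (Sum.inr (j, t)) (by simpa using hst)
  · rintro ⟨bo, hbo, hbetw⟩
    have hlex : IsStrictTotalOrder (BetwSCAgent n m)
        (Sum.Lex bo (Prod.Lex (· < ·) (· < ·))) := { }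
    refine ⟨_, hlex, ?_⟩
    rintro (i | ⟨j, s⟩) (i' | ⟨k, t⟩) hne
    · rcases le_total i i' with h | h
      · refine Or.inl (Profile.setBefore_prefersSet_ofRank _ ?_).2
        rintro (v | ⟨l, r⟩) a b ha hb <;> simp [betwSCRank] at ha hb
        rw [← ha.2, ← hb.2]
        exact h
      · refine Or.inl (Profile.setBefore_prefersSet_ofRank _ ?_).1
        rintro (v | ⟨l, r⟩) a b ha hb <;> simp [betwSCRank] at ha hb
        rw [← ha.2, ← hb.2]
        exact h
    · refine Or.inl (Profile.setBefore_prefersSet_ofRank _ ?_).1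
      rintro (v | ⟨l, r⟩) a b ha hb <;> simp [betwSCRank] at ha hb
    · refine Or.inl (Profile.setBefore_prefersSet_ofRank _ ?_).1
      rintro (v | ⟨l, r⟩) a b ha hb <;> simp [betwSCRank] at ha hb
    · rcases lt_trichotomy j k with h | rfl | h
      · refine Or.inl (Profile.setBefore_prefersSet_ofRank _ ?_).2
        rintro (v | ⟨l, r⟩) a b ha hb
        · have := betwSCRank_inl_bounds ha
          have := betwSCRank_inl_bounds hb
          omega
        · simp [betwSCRank] at ha
      · exact (block_setBefore_iff hdist j).mpr (by simpa using hbetw j) s t (by simpa using hne)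
      · refine Or.inl (Profile.setBefore_prefersSet_ofRank _ ?_).1
        rintro (v | ⟨l, r⟩) a b ha hb
        · have := betwSCRank_inl_bounds ha
          have := betwSCRank_inl_bounds hb
          omega
        · simp [betwSCRank] at ha
end

section
/- The complete preference profile with ties on agents {1,2,3,4} given by: agent 1: 1 ≻ 2 ≻ 3 ≻ 4; agent 2: 2 ≻ 3 ≻ 1 ≻ 4; agent 3: 3 ≻ 2 ∼ 4 ≻ 1; agent 4: 4 ≻ 3 ≻ 2 ≻ 1, is narcissistic and single-peaked with respect to the order 1 ▷ 2 ▷ 3 ▷ 4, and it admits exactly two stable matchings, namely M_1 = {{1,2},{3,4}} and M_2 = {{1,4},{2,3}}; both are perfect. Hence for complete, narcissistic, single-peaked preferences with ties, the stable matching need not be unique. -/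
/-- The rank table of the profile of Example 1 (agent `i` is index `i - 1`):
agent 1: 1 ≻ 2 ≻ 3 ≻ 4; agent 2: 2 ≻ 3 ≻ 1 ≻ 4; agent 3: 3 ≻ 2 ∼ 4 ≻ 1;
agent 4: 4 ≻ 3 ≻ 2 ≻ 1. -/
def exampleRank : Fin 4 → Fin 4 → Option ℕ :=
  ![![some 0, some 1, some 2, some 3],
    ![some 2, some 0, some 1, some 3],
    ![some 2, some 1, some 0, some 1],
    ![some 3, some 2, some 1, some 0]]

/-- The numerical ranks underlying `exampleRank`. -/
def exampleRankNat : Fin 4 → Fin 4 → ℕ :=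
  ![![0, 1, 2, 3], ![2, 0, 1, 3], ![2, 1, 0, 1], ![3, 2, 1, 0]]

theorem exampleRank_eq (i x : Fin 4) : exampleRank i x = some (exampleRankNat i x) := by
  revert i x; decide

theorem mem_acc_exampleRank (i x : Fin 4) : x ∈ (Profile.ofRank exampleRank).acc i := by
  simp [Profile.ofRank, exampleRank_eq]

theorem pref_exampleRank_iff (i x y : Fin 4) :
    (Profile.ofRank exampleRank).pref i x y ↔ exampleRankNat i x ≤ exampleRankNat i y := by
  simp [Profile.ofRank, exampleRank_eq]

theorem strict_exampleRank_iff (i x y : Fin 4) :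
    (Profile.ofRank exampleRank).Strict i x y ↔ exampleRankNat i x < exampleRankNat i y := by
  simp only [Profile.Strict, pref_exampleRank_iff]
  omega

theorem stable_exampleRank_iff (M : (Profile.ofRank exampleRank).Matching) :
    M.Stable ↔ ∀ x y : Fin 4, ¬ (x ≠ y ∧ M.m x ≠ some y ∧
      (∀ z, M.m x = some z → exampleRankNat x y < exampleRankNat x z) ∧
      (∀ z, M.m y = some z → exampleRankNat y x < exampleRankNat y z)) := by
  simp only [Profile.Matching.Stable, Profile.Matching.Blocks, mem_acc_exampleRank,
    strict_exampleRank_iff, true_and]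

/-- The matching on the example profile given by an irreflexive symmetric partner function. -/
def exampleMatching (f : Fin 4 → Option (Fin 4)) (hne : ∀ x y, f x = some y → x ≠ y)
    (hsymm : ∀ x y, f x = some y → f y = some x) : (Profile.ofRank exampleRank).Matching where
  m := f
  ne := hne
  mutual_acc _ _ _ := ⟨mem_acc_exampleRank _ _, mem_acc_exampleRank _ _⟩
  symm := hsymm

set_option synthInstance.maxSize 2000 in
theorem partner_eq_of_no_blocking_pair : ∀ a b c d : Option (Fin 4),
    (∀ x y : Fin 4, ![a, b, c, d] x = some y → x ≠ y ∧ ![a, b, c, d] y = some x) →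
    (∀ x y : Fin 4, ¬ (x ≠ y ∧ ![a, b, c, d] x ≠ some y ∧
      (∀ z, ![a, b, c, d] x = some z → exampleRankNat x y < exampleRankNat x z) ∧
      (∀ z, ![a, b, c, d] y = some z → exampleRankNat y x < exampleRankNat y z))) →
    ![a, b, c, d] = ![some 1, some 0, some 3, some 2] ∨
      ![a, b, c, d] = ![some 3, some 2, some 1, some 0] := by
  decide +kernel

/-- The complete profile with ties of Example 1 is narcissistic
and single-peaked w.r.t. `1 ▷ 2 ▷ 3 ▷ 4`, and it admits exactly two stable
matchings, `M₁ = {{1,2},{3,4}}` and `M₂ = {{1,4},{2,3}}`, both perfect.  Hence for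
complete, narcissistic, single-peaked preferences with ties the stable matching
need not be unique. -/
theorem example_two_stable_matchings :
    (Profile.ofRank exampleRank).IsComplete ∧
    (Profile.ofRank exampleRank).Narcissistic ∧
    (Profile.ofRank exampleRank).SinglePeakedWrt (· < ·) ∧
    ∃ M₁ M₂ : (Profile.ofRank exampleRank).Matching,
      M₁.m = ![some 1, some 0, some 3, some 2] ∧
      M₂.m = ![some 3, some 2, some 1, some 0] ∧
      M₁.Stable ∧ M₂.Stable ∧ M₁.Perfect ∧ M₂.Perfect ∧
      ∀ M : (Profile.ofRank exampleRank).Matching,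
        M.Stable → M.m = M₁.m ∨ M.m = M₂.m := by
  refine ⟨fun i ↦ Set.eq_univ_of_forall fun x ↦ Or.inl (mem_acc_exampleRank i x),
    fun i ↦ ⟨mem_acc_exampleRank i i, fun j _ hj ↦ ?_⟩, fun i x y z _ _ _ hxy hyz h ↦ ?_,
    exampleMatching ![some 1, some 0, some 3, some 2] (by decide) (by decide),
    exampleMatching ![some 3, some 2, some 1, some 0] (by decide) (by decide),
    rfl, rfl, ?_, ?_, ?_, ?_, fun M hM ↦ ?_⟩
  · rw [strict_exampleRank_iff]
    exact (by decide : ∀ i j : Fin 4, j ≠ i → exampleRankNat i i < exampleRankNat i j) i j hj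
  · rw [strict_exampleRank_iff] at h
    rw [pref_exampleRank_iff]
    exact (by decide : ∀ i x y z : Fin 4, x < y → y < z →
      exampleRankNat i x < exampleRankNat i y → exampleRankNat i y ≤ exampleRankNat i z)
      i x y z hxy hyz h
  · rw [stable_exampleRank_iff]
    simp only [exampleMatching]
    decide
  · rw [stable_exampleRank_iff]
    simp only [exampleMatching]
    decide
  · simp only [Profile.Matching.Perfect, exampleMatching]
    decide
  · simp only [Profile.Matching.Perfect, exampleMatching]
    decide
  · have hm : M.m = ![M.m 0, M.m 1, M.m 2, M.m 3] := by
      ext1 x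
      fin_cases x <;> rfl
    rw [stable_exampleRank_iff] at hM
    have hne : ∀ x y, M.m x = some y → x ≠ y ∧ M.m y = some x :=
      fun x y h ↦ ⟨M.ne x y h, M.symm x y h⟩
    have key := partner_eq_of_no_blocking_pair (M.m 0) (M.m 1) (M.m 2) (M.m 3)
    rw [← hm] at key
    exact key hne hM
end
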